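/- arXiv:1112.1335 — 3 statements merged into one kernel-verified Lean document; each statement's English description precedes it below -/
import Mathlib

section
/- Let V_i : ℝ × ℝ^d → ℝ (i = 1,…,n) be continuously differentiable, let x : (a,b) → ℝ^d be differentiable, and set V(t) = max_{i=1,…,n} V_i(t, x(t)). Let I(t) = { i : V(t) = V_i(t, x(t)) } be the set of indices where the maximum is attained at time t. Then for every t ∈ (a,b), D⁺V(t) = max_{i ∈ I(t)} (d/ds) V_i(s, x(s))|_{s=t}, i.e. the upper Dini derivative of V along the trajectory equals the maximum over active indices of ∂_t V_i(t, x(t)) + ⟨∇_x V_i(t, x(t)), ẋ(t)⟩. -/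
open Metric Set Filter

noncomputable section

/-- The upper Dini derivative `D⁺h(t) = limsup_{s→0⁺} (h(t+s) − h(t))/s`. -/
def upperDini (h : ℝ → ℝ) (t : ℝ) : ℝ :=
  Filter.limsup (fun s => (h (t + s) - h t) / s) (nhdsWithin 0 (Set.Ioi 0))

/-- The maximum of finitely many functions differentiable at `t` has a right derivative at `t`,
namely the maximum of the derivatives of the functions attaining the maximum at `t`. -/
theorem tendsto_slope_iSup_of_hasDerivAt {ι : Type*} [Finite ι] [Nonempty ι]
    {f : ι → ℝ → ℝ} {f' : ι → ℝ} {t : ℝ} (hf : ∀ i, HasDerivAt (f i) (f' i) t) :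
    Tendsto (fun s => ((⨆ i, f i (t + s)) - ⨆ i, f i t) / s) (nhdsWithin 0 (Ioi 0))
      (nhds (⨆ i : {i // f i t = ⨆ j, f j t}, f' i)) := by
  obtain ⟨i₀, hi₀⟩ := exists_eq_ciSup_of_finite (f := fun i => f i t)
  have : Nonempty {i // f i t = ⨆ j, f j t} := ⟨⟨i₀, hi₀⟩⟩
  have := Fintype.ofFinite {i // f i t = ⨆ j, f j t}
  have hlim : Tendsto
      (fun s => ⨆ i : {i // f i t = ⨆ j, f j t}, (f i (t + s) - f i t) / s)
      (nhdsWithin 0 (Ioi 0)) (nhds (⨆ i : {i // f i t = ⨆ j, f j t}, f' i)) := by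
    simp only [← Finset.sup'_univ_eq_ciSup]
    refine Tendsto.finset_sup'_nhds_apply Finset.univ_nonempty fun i _ => ?_
    simpa [div_eq_inv_mul] using (hf i).tendsto_slope_zero_right
  have hshift : Tendsto (fun s => t + s) (nhdsWithin 0 (Ioi 0)) (nhds t) := by
    have : Tendsto (fun s => t + s) (nhds 0) (nhds (t + 0)) := tendsto_const_nhds.add tendsto_id
    rw [add_zero] at this
    exact this.mono_left nhdsWithin_le_nhds
  have hdom : ∀ᶠ s in nhdsWithin 0 (Ioi 0),
      ∀ j, f j t ≠ (⨆ k, f k t) → f j (t + s) < f i₀ (t + s) := by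
    refine eventually_all.2 fun j => ?_
    by_cases hj : f j t = ⨆ k, f k t
    · exact Eventually.of_forall fun s h => absurd hj h
    · have hlt : f j t < f i₀ t :=
        lt_of_le_of_ne (hi₀ ▸ le_ciSup (finite_range fun k => f k t).bddAbove j)
          (hi₀ ▸ hj)
      filter_upwards [((hf j).continuousAt.tendsto.comp hshift).eventually_lt
        ((hf i₀).continuousAt.tendsto.comp hshift) hlt] with s hs _ using hs
  refine hlim.congr' ?_
  filter_upwards [hdom, self_mem_nhdsWithin] with s hs hpos
  have hmax : ⨆ i, f i (t + s) = ⨆ i : {i // f i t = ⨆ j, f j t}, f i (t + s) := by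
    refine le_antisymm (ciSup_le fun j => ?_)
      (ciSup_le fun i => le_ciSup (finite_range fun k => f k (t + s)).bddAbove i.1)
    have hbdd := (finite_range fun i : {i // f i t = ⨆ j, f j t} => f i (t + s)).bddAbove
    by_cases hj : f j t = ⨆ k, f k t
    · exact le_ciSup hbdd ⟨j, hj⟩
    · exact (hs j hj).le.trans (le_ciSup hbdd ⟨i₀, hi₀⟩)
  rw [hmax, ciSup_sub (finite_range _).bddAbove, div_eq_mul_inv,
    Real.iSup_mul_of_nonneg (inv_nonneg.2 (le_of_lt hpos))]
  exact iSup_congr fun i => by rw [i.2, div_eq_mul_inv]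

/-- **Lemma 2 (Danskin-type).**  Let `V_i : ℝ × ℝ^d → ℝ`, `i = 1,…,m`, be `C¹`,
let `x : (a,b) → ℝ^d` be differentiable and `V(t) = max_i V_i(t, x(t))`.  Then
for `t ∈ (a,b)`, the upper Dini derivative of `V` at `t` equals the maximum of
`(d/ds) V_i(s, x(s))|_{s=t}` over the indices `i` where the maximum is
attained at `t`. -/
theorem dini_max_rule {d m : ℕ} (hm : 0 < m) (a b : ℝ) (hab : a < b)
    (V : Fin m → ℝ × EuclideanSpace ℝ (Fin d) → ℝ)
    (hV : ∀ i, ContDiff ℝ 1 (V i))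
    (x : ℝ → EuclideanSpace ℝ (Fin d))
    (hx : ∀ t ∈ Set.Ioo a b, DifferentiableAt ℝ x t)
    (t : ℝ) (ht : t ∈ Set.Ioo a b) :
    upperDini (fun s => ⨆ i : Fin m, V i (s, x s)) t =
      ⨆ i : {i : Fin m // V i (t, x t) = ⨆ i' : Fin m, V i' (t, x t)},
        deriv (fun s => V i.1 (s, x s)) t := by
  have : Nonempty (Fin m) := ⟨⟨0, hm⟩⟩
  have hderiv : ∀ i, HasDerivAt (fun s => V i (s, x s)) (deriv (fun s => V i (s, x s)) t) t :=
    fun i => (((hV i).differentiable one_ne_zero).differentiableAt.comp t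
      (differentiableAt_id.prodMk (hx t ht))).hasDerivAt
  exact (tendsto_slope_iSup_of_hasDerivAt hderiv).limsup_eq
end
end

section
/- If the switching interaction graph G_{σ(t)} is uniformly jointly L-connected (UJLC), then the system is SISS with respect to ℒ(y(t)) with input z; moreover the gain γ can be taken linear. -/
open Metric Set Filter MeasureTheory

noncomputable section

/-- Data of the multi-agent system (5): the switching communication topology
(neighbor sets `Nb`, leader sets `Ld`), the weight functions `A` (= `a_{ij}`),
`B` (= `b_{ij}`), the dwell time `τD` and the weight bounds `aLo = a_*`,
`aHi = a^*`, `bLo = b_*`, together with Assumptions 1 and 2. -/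
structure MASData (d n k : ℕ) where
  hn : 2 ≤ n
  hk : 1 ≤ k
  Nb : ℝ → Fin n → Finset (Fin n)
  Ld : ℝ → Fin n → Finset (Fin k)
  A : Fin n → Fin n → (Fin n → EuclideanSpace ℝ (Fin d)) →
    (Fin k → EuclideanSpace ℝ (Fin d)) → ℝ → ℝ
  B : Fin n → Fin k → (Fin n → EuclideanSpace ℝ (Fin d)) →
    (Fin k → EuclideanSpace ℝ (Fin d)) → ℝ → ℝ
  τD : ℝ
  aLo : ℝ
  aHi : ℝ
  bLo : ℝ
  τD_pos : 0 < τD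
  aLo_pos : 0 < aLo
  bLo_pos : 0 < bLo
  A_bdd : ∀ i j xv yv t, aLo ≤ A i j xv yv t ∧ A i j xv yv t ≤ aHi
  B_bdd : ∀ i j xv yv t, bLo ≤ B i j xv yv t
  A_cont : ∀ i j, Continuous fun p :
    (Fin n → EuclideanSpace ℝ (Fin d)) × (Fin k → EuclideanSpace ℝ (Fin d)) × ℝ =>
    A i j p.1 p.2.1 p.2.2
  B_cont : ∀ i j, Continuous fun p :
    (Fin n → EuclideanSpace ℝ (Fin d)) × (Fin k → EuclideanSpace ℝ (Fin d)) × ℝ =>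
    B i j p.1 p.2.1 p.2.2
  /-- The topology is piecewise constant with consecutive switching instants
  separated by at least the dwell time `τD` (Assumption 1). -/
  dwell : ∃ s : ℕ → ℝ, s 0 = 0 ∧ (∀ m : ℕ, s m + τD ≤ s (m + 1)) ∧
    ∀ m : ℕ, ∀ t₁ ∈ Set.Ico (s m) (s (m + 1)), ∀ t₂ ∈ Set.Ico (s m) (s (m + 1)),
      Nb t₁ = Nb t₂ ∧ Ld t₁ = Ld t₂

namespace MASData

variable {d n k : ℕ}

/-- The arc relation of the communication graph at time `t`, on the node set
`Fin k ⊕ Fin n` (leaders ⊕ followers).  `arcAt t v v'` means there is an arc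
leaving `v` and entering `v'`; there are no arcs from followers into leaders. -/
def arcAt (D : MASData d n k) (t : ℝ) (v v' : Fin k ⊕ Fin n) : Prop :=
  match v, v' with
  | Sum.inl j, Sum.inr i => j ∈ D.Ld t i
  | Sum.inr j, Sum.inr i => j ∈ D.Nb t i
  | _, _ => False

/-- Arc relation of the union graph over the set of times `T`. -/
def arcOn (D : MASData d n k) (T : Set ℝ) (v v' : Fin k ⊕ Fin n) : Prop :=
  ∃ t ∈ T, D.arcAt t v v'

/-- The union graph over the set of times `T` is L-connected: every follower is
reachable from some leader by a directed path. -/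
def LConnectedOn (D : MASData d n k) (T : Set ℝ) : Prop :=
  ∀ i : Fin n, ∃ j : Fin k, Relation.ReflTransGen (D.arcOn T) (Sum.inl j) (Sum.inr i)

/-- Uniformly jointly L-connected. -/
def UJLC (D : MASData d n k) : Prop :=
  ∃ T > (0:ℝ), ∀ t ≥ (0:ℝ), D.LConnectedOn (Set.Ico t (t + T))

/-- Jointly L-connected. -/
def JLC (D : MASData d n k) : Prop :=
  ∀ t ≥ (0:ℝ), D.LConnectedOn (Set.Ici t)

end MASData

/-- A solution (trajectory) of system (5) together with its inputs: leader
controls `u`, disturbances `w`, follower states `x` and leader states `y`;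
the dynamics hold in the sense of right derivatives for `t ≥ 0`, and the
(piecewise continuous) inputs are locally interval integrable along the
solution. -/
structure MASSol {d n k : ℕ} (D : MASData d n k) where
  x : ℝ → Fin n → EuclideanSpace ℝ (Fin d)
  y : ℝ → Fin k → EuclideanSpace ℝ (Fin d)
  u : Fin k → (Fin k → EuclideanSpace ℝ (Fin d)) → ℝ → EuclideanSpace ℝ (Fin d)
  w : Fin n → ℝ → EuclideanSpace ℝ (Fin d)
  u_cont : ∀ j t, Continuous fun yv => u j yv t
  w_cont : ∀ i, Continuous (w i)
  x_cont : ∀ i, Continuous fun t => x t i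
  y_cont : ∀ j, Continuous fun t => y t j
  dyn_y : ∀ (j : Fin k), ∀ t ≥ (0:ℝ),
    HasDerivWithinAt (fun s => y s j) (u j (y t) t) (Set.Ici t) t
  dyn_x : ∀ (i : Fin n), ∀ t ≥ (0:ℝ),
    HasDerivWithinAt (fun s => x s i)
      ((∑ j ∈ D.Nb t i, D.A i j (x t) (y t) t • (x t j - x t i)) +
        (∑ j ∈ D.Ld t i, D.B i j (x t) (y t) t • (y t j - x t i)) + w i t)
      (Set.Ici t) t
  r_int : ∀ a b : ℝ, IntervalIntegrable (fun t => ⨆ j : Fin k, ‖u j (y t) t‖)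
    MeasureTheory.volume a b
  q_int : ∀ a b : ℝ, IntervalIntegrable
    (fun t => (⨆ j : Fin k, ‖u j (y t) t‖) + ⨆ i : Fin n, ‖w i t‖)
    MeasureTheory.volume a b
  z_int : ∀ a b : ℝ, IntervalIntegrable
    (fun t => Real.sqrt ((∑ j : Fin k, ‖u j (y t) t‖ ^ 2) + ∑ i : Fin n, ‖w i t‖ ^ 2))
    MeasureTheory.volume a b

namespace MASSol

variable {d n k : ℕ} {D : MASData d n k}

/-- The moving multi-leader set `ℒ(y(t))`: the convex hull of the leaders. -/
def Lset (sol : MASSol D) (t : ℝ) : Set (EuclideanSpace ℝ (Fin d)) :=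
  convexHull ℝ (Set.range (sol.y t))

/-- `|x(t)|_{ℒ(y(t))}`: the maximal distance of the followers from `ℒ(y(t))`. -/
def distL (sol : MASSol D) (t : ℝ) : ℝ :=
  ⨆ i : Fin n, Metric.infDist (sol.x t i) (sol.Lset t)

/-- `r(t) = max_j |u_j(y(t),t)|`. -/
def rmax (sol : MASSol D) (t : ℝ) : ℝ := ⨆ j : Fin k, ‖sol.u j (sol.y t) t‖

/-- `q(t) = max_j |u_j(y(t),t)| + max_i |w_i(t)|`. -/
def qmax (sol : MASSol D) (t : ℝ) : ℝ := sol.rmax t + ⨆ i : Fin n, ‖sol.w i t‖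

/-- `|z(t)|`: the Euclidean norm of the combined input `z = (u, w)` at time `t`. -/
def znorm (sol : MASSol D) (t : ℝ) : ℝ :=
  Real.sqrt ((∑ j : Fin k, ‖sol.u j (sol.y t) t‖ ^ 2) + ∑ i : Fin n, ‖sol.w i t‖ ^ 2)

/-- `‖z‖_∞ = sup_{t ≥ 0} |z(t)|`. -/
def zsup (sol : MASSol D) : ℝ := sSup (sol.znorm '' Set.Ici 0)

/-- The combined input `z` is (essentially) bounded, i.e. `z ∈ L_∞`. -/
def zBounded (sol : MASSol D) : Prop := BddAbove (sol.znorm '' Set.Ici 0)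

end MASSol

/-- Class-𝒦 function on `[0,∞)`. -/
def IsClassK (γ : ℝ → ℝ) : Prop :=
  ContinuousOn γ (Set.Ici 0) ∧ StrictMonoOn γ (Set.Ici 0) ∧ γ 0 = 0

/-- Class-𝒦𝓛 function. -/
def IsClassKL (β : ℝ → ℝ → ℝ) : Prop :=
  (∀ t ≥ (0:ℝ), IsClassK fun s => β s t) ∧
  (∀ s ≥ (0:ℝ), AntitoneOn (fun t => β s t) (Set.Ici 0) ∧
    Filter.Tendsto (fun t => β s t) Filter.atTop (nhds 0))

/-- System (5) is (generalized) set input-to-state stable with respect to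
`ℒ(y(t))` with input `z`. -/
def MASData.SISS {d n k : ℕ} (D : MASData d n k) : Prop :=
  ∃ β γ, IsClassKL β ∧ IsClassK γ ∧
    ∀ sol : MASSol D, sol.zBounded →
      ∀ t ≥ (0:ℝ), sol.distL t ≤ β (sol.distL 0) t + γ sol.zsup

/-- System (5) is (generalized) set integral-input-to-state stable with respect
to `ℒ(y(t))`. -/
def MASData.SiISS {d n k : ℕ} (D : MASData d n k) : Prop :=
  ∃ β γ, IsClassKL β ∧ IsClassK γ ∧
    ∀ sol : MASSol D, ∀ t ≥ (0:ℝ),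
      sol.distL t ≤ β (sol.distL 0) t + ∫ s in (0:ℝ)..t, γ (sol.znorm s)

open scoped Topology

section ConvexDistance

variable {E : Type*} [NormedAddCommGroup E] [NormedSpace ℝ E]

theorem convexOn_infDist {C : Set E} (hC : Convex ℝ C) (hne : C.Nonempty) :
    ConvexOn ℝ univ fun z => infDist z C := by
  refine ⟨convex_univ, fun p _ q _ a b ha hb hab => le_of_forall_pos_le_add fun ε hε => ?_⟩
  obtain ⟨p', hp', hpp'⟩ := (infDist_lt_iff hne).1 (lt_add_of_pos_right (infDist p C) hε)
  obtain ⟨q', hq', hqq'⟩ := (infDist_lt_iff hne).1 (lt_add_of_pos_right (infDist q C) hε)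
  have hdist : dist (a • p + b • q) (a • p' + b • q') ≤ a * dist p p' + b * dist q q' := by
    refine (dist_add_add_le _ _ _ _).trans_eq ?_
    rw [dist_smul₀, dist_smul₀, Real.norm_of_nonneg ha, Real.norm_of_nonneg hb]
  have hmem := infDist_le_dist_of_mem (x := a • p + b • q) (hC hp' hq' ha hb hab)
  have h₁ := mul_le_mul_of_nonneg_left hpp'.le ha
  have h₂ := mul_le_mul_of_nonneg_left hqq'.le hb
  have h₃ : a * ε + b * ε = ε := by rw [← add_mul, hab, one_mul]
  simp only [smul_eq_mul]
  linarith

theorem ConvexOn.map_add_sum_smul_sub_le {ι : Type*} {f : E → ℝ} (hf : ConvexOn ℝ univ f)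
    (s : Finset ι) {c : ι → ℝ} (p : ι → E) (q : E) (hc : ∀ i ∈ s, 0 ≤ c i)
    (hsum : ∑ i ∈ s, c i ≤ 1) :
    f (q + ∑ i ∈ s, c i • (p i - q)) ≤ f q + ∑ i ∈ s, c i * (f (p i) - f q) := by
  have h := hf.map_add_sum_le (v := 1 - ∑ i ∈ s, c i) (q := q) (p := p) hc (by ring)
    (fun _ _ => mem_univ _) (by linarith) (mem_univ _)
  have hpt : q + ∑ i ∈ s, c i • (p i - q) =
      (1 - ∑ i ∈ s, c i) • q + ∑ i ∈ s, c i • p i := by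
    simp only [smul_sub, Finset.sum_sub_distrib, ← Finset.sum_smul, sub_smul, one_smul]
    abel
  rw [hpt]
  refine h.trans_eq ?_
  simp only [mul_sub, Finset.sum_sub_distrib, ← Finset.sum_mul, smul_eq_mul]
  ring

theorem infDist_convexHull_range_le {κ : Type*} [Nonempty κ] {y y' : κ → E} {e : ℝ}
    (hy : ∀ j, dist (y j) (y' j) ≤ e) (z : E) :
    infDist z (convexHull ℝ (range y')) ≤ infDist z (convexHull ℝ (range y)) + e := by
  have hne : (convexHull ℝ (range y)).Nonempty := (range_nonempty y).convexHull
  have hne' : (convexHull ℝ (range y')).Nonempty := (range_nonempty y').convexHull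
  have hsub : convexHull ℝ (range y) ⊆
      {p | p ∈ univ ∧ infDist p (convexHull ℝ (range y')) ≤ e} := by
    refine convexHull_min ?_ ((convexOn_infDist (convex_convexHull ℝ _) hne').convex_le e)
    rintro _ ⟨j, rfl⟩
    exact ⟨mem_univ _, (infDist_le_dist_of_mem
      (subset_convexHull ℝ _ (mem_range_self j))).trans (hy j)⟩
  refine le_of_forall_pos_le_add fun ε hε => ?_
  obtain ⟨p, hp, hzp⟩ := (infDist_lt_iff hne).1
    (lt_add_of_pos_right (infDist z (convexHull ℝ (range y))) hε)
  have h₁ := infDist_le_infDist_add_dist (s := convexHull ℝ (range y')) (x := z) (y := p)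
  have h₂ := (hsub hp).2
  linarith

end ConvexDistance

/-- The upper right Dini derivative of `f` at `t` is at most `v`. -/
def RightDiniLE (f : ℝ → ℝ) (t v : ℝ) : Prop :=
  ∀ r, v < r → ∀ᶠ s in 𝓝[>] t, (s - t)⁻¹ * (f s - f t) < r

namespace RightDiniLE

theorem mono {f : ℝ → ℝ} {t v v' : ℝ} (h : RightDiniLE f t v) (hv : v ≤ v') :
    RightDiniLE f t v' :=
  fun r hr => h r (hv.trans_lt hr)

theorem sub_linear {f : ℝ → ℝ} {t v : ℝ} (h : RightDiniLE f t v) (q t₀ : ℝ) :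
    RightDiniLE (fun s => f s - q * (s - t₀)) t (v - q) := by
  intro r hr
  filter_upwards [h (r + q) (by linarith), self_mem_nhdsWithin] with s hs hst
  have hst : 0 < s - t := sub_pos.2 hst
  have : (s - t)⁻¹ * (f s - q * (s - t₀) - (f t - q * (t - t₀))) =
      (s - t)⁻¹ * (f s - f t) - q := by
    field_simp
    ring
  linarith

theorem le_gronwallBound {f f' : ℝ → ℝ} {δ K ε a b : ℝ} (hf : ContinuousOn f (Icc a b))
    (hf' : ∀ t ∈ Ico a b, RightDiniLE f t (f' t)) (ha : f a ≤ δ)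
    (bound : ∀ t ∈ Ico a b, f' t ≤ K * f t + ε) (hab : a ≤ b) :
    f b ≤ gronwallBound δ K ε (b - a) :=
  le_gronwallBound_of_liminf_deriv_right_le hf (fun t ht r hr => (hf' t ht r hr).frequently)
    ha bound b (right_mem_Icc.2 hab)

theorem le_sub_of_forced_decay {f : ℝ → ℝ} {M K e η a b : ℝ} (hK : 0 < K)
    (hf : ContinuousOn f (Icc a b)) (hab : a ≤ b)
    (hf' : ∀ t ∈ Ico a b, RightDiniLE f t (K * (M - f t) - e)) (ha : f a ≤ M - η) :
    f b ≤ M - (η * Real.exp (-K * (b - a)) + e / K * (1 - Real.exp (-K * (b - a)))) := by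
  have h := le_gronwallBound (K := -K) (ε := K * M - e) hf hf' ha
    (fun t _ => by linarith) hab
  rw [gronwallBound_of_K_ne_0 (neg_ne_zero.2 hK.ne')] at h
  refine h.trans_eq ?_
  have hne := hK.ne'
  field_simp
  ring

theorem ciSup {ι : Type*} [Fintype ι] [Nonempty ι] {f : ι → ℝ → ℝ} {t v : ℝ}
    (hc : ∀ i, Continuous (f i))
    (h : ∀ i, (∀ j, f j t ≤ f i t) → RightDiniLE (f i) t v) :
    RightDiniLE (fun s => ⨆ i, f i s) t v := by
  intro r hr
  have hbdd : ∀ s, BddAbove (range fun i => f i s) := fun s => (finite_range _).bddAbove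
  have key : ∀ i, ∀ᶠ s in 𝓝[>] t, f i s < (⨆ j, f j t) + r * (s - t) := by
    intro i
    by_cases hi : ∀ j, f j t ≤ f i t
    · filter_upwards [h i hi r hr, self_mem_nhdsWithin] with s hs hst
      have hst : 0 < s - t := sub_pos.2 hst
      rw [inv_mul_lt_iff₀ hst] at hs
      have := le_ciSup (hbdd t) i
      linarith
    · push Not at hi
      obtain ⟨j, hj⟩ := hi
      have hlt : f i t < (⨆ j, f j t) + r * (t - t) := by
        have := le_ciSup (hbdd t) j
        simp only [sub_self, mul_zero, add_zero]
        linarith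
      have : ∀ᶠ s in 𝓝 t, f i s < (⨆ j, f j t) + r * (s - t) :=
        (hc i).continuousAt.eventually_lt
          (Continuous.continuousAt (by fun_prop)) hlt
      exact this.filter_mono nhdsWithin_le_nhds
  filter_upwards [eventually_all.2 key, self_mem_nhdsWithin] with s hs hst
  have hst : 0 < s - t := sub_pos.2 hst
  rw [inv_mul_lt_iff₀ hst]
  obtain ⟨i, hi⟩ := exists_eq_ciSup_of_finite (f := fun i => f i s)
  rw [← hi]
  linarith [hs i]

end RightDiniLE

namespace MASData

variable {d n k : ℕ} {D : MASData d n k}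

theorem exists_boundary_arc {T : Set ℝ} (h : D.LConnectedOn T) {S : Finset (Fin n)}
    (hS : S ≠ Finset.univ) :
    ∃ i ∉ S, ∃ v, D.arcOn T v (Sum.inr i) ∧ ∀ j, v = Sum.inr j → j ∈ S := by
  obtain ⟨i₀, hi₀⟩ : ∃ i, i ∉ S := by
    by_contra! hall
    exact hS (Finset.eq_univ_iff_forall.2 hall)
  obtain ⟨l, hl⟩ := h i₀
  by_contra! hno
  have key : ∀ v, Relation.ReflTransGen (D.arcOn T) (Sum.inl l) v →
      ∀ j, v = Sum.inr j → j ∈ S := by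
    intro v hv
    induction hv with
    | refl => intro j hj; cases hj
    | @tail v v' _ harc ih =>
      rintro j rfl
      by_contra hj
      obtain ⟨j', hj', hj'S⟩ := hno j hj v harc
      exact hj'S (ih j' hj')
  exact hi₀ (key _ hl i₀ rfl)

theorem exists_arc_interval {a b : ℝ} (ha : 0 ≤ a) {v v' : Fin k ⊕ Fin n}
    (h : D.arcOn (Ico (a + D.τD / 2) (a + D.τD / 2 + b)) v v') :
    ∃ p, a ≤ p ∧ p + D.τD / 2 ≤ a + (b + D.τD) ∧
      ∀ t ∈ Ico p (p + D.τD / 2), D.arcAt t v v' := by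
  obtain ⟨t, ht, harc⟩ := h
  obtain ⟨s, hs0, hstep, hconst⟩ := D.dwell
  have hτ := D.τD_pos
  have hgrow : ∀ m : ℕ, m * D.τD ≤ s m := by
    intro m
    induction m with
    | zero => simp [hs0]
    | succ m ih => have := hstep m; push_cast; linarith
  have hex : ∃ m : ℕ, t < s m := by
    obtain ⟨m, hm⟩ := exists_nat_gt (t / D.τD)
    exact ⟨m, ((div_lt_iff₀ hτ).1 hm).trans_le (hgrow m)⟩
  classical
  obtain ⟨m, hm, hm'⟩ : ∃ m, s m ≤ t ∧ t < s (m + 1) := by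
    have hpos : Nat.find hex ≠ 0 := by
      intro h0
      have := Nat.find_spec hex
      rw [h0, hs0] at this
      linarith [ht.1]
    obtain ⟨m, hm⟩ := Nat.exists_eq_succ_of_ne_zero hpos
    refine ⟨m, not_lt.1 (Nat.find_min hex (by omega)), ?_⟩
    have := Nat.find_spec hex
    rwa [hm] at this
  have hmem : t ∈ Ico (s m) (s (m + 1)) := ⟨hm, hm'⟩
  have hpersist : ∀ r ∈ Ico (s m) (s (m + 1)), D.arcAt r v v' := by
    intro r hr
    obtain ⟨hN, hL⟩ := hconst m r hr t hmem
    rcases v with j | j <;> rcases v' with i | i <;> simp_all only [arcAt]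
  have hlen := hstep m
  rcases le_or_gt (s m + D.τD / 2) t with hlong | hshort
  · refine ⟨t - D.τD / 2, by linarith [ht.1], by linarith [ht.2], fun r hr => hpersist r ?_⟩
    exact ⟨by linarith [hr.1], by linarith [hr.2]⟩
  · refine ⟨t, by linarith [ht.1], by linarith [ht.2], fun r hr => hpersist r ?_⟩
    exact ⟨by linarith [hr.1], by linarith [hr.2]⟩

/-- The factor by which the guaranteed slack of the informed followers shrinks over a window of
length `W` that activates an arc for half a dwell time. -/
def slackRatio (c K τ W : ℝ) : ℝ :=
  c / K * (1 - Real.exp (-K * (τ / 2))) * Real.exp (-K * W) * Real.exp (-K * W)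

theorem slackRatio_pos {c K τ W : ℝ} (hc : 0 < c) (hK : 0 < K) (hτ : 0 < τ) :
    0 < slackRatio c K τ W := by
  have : Real.exp (-K * (τ / 2)) < 1 := Real.exp_lt_one_iff.2 (by nlinarith)
  have := sub_pos.2 this
  unfold slackRatio
  positivity

theorem slackRatio_lt_exp {c K τ W : ℝ} (hc : 0 < c) (hcK : c ≤ K) (hτ : 0 < τ) (hW : 0 < W) :
    slackRatio c K τ W < Real.exp (-K * W) := by
  have hK := hc.trans_le hcK
  have h₁ : Real.exp (-K * (τ / 2)) < 1 := Real.exp_lt_one_iff.2 (by nlinarith)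
  have h₂ : Real.exp (-K * W) < 1 := Real.exp_lt_one_iff.2 (by nlinarith)
  have h₃ : c / K ≤ 1 := (div_le_one hK).2 hcK
  have h₄ := Real.exp_pos (-K * (τ / 2))
  have h₅ := Real.exp_pos (-K * W)
  have h₆ : c / K * (1 - Real.exp (-K * (τ / 2))) ≤ 1 := by
    have : 0 ≤ c / K := by positivity
    nlinarith
  have h₇ : c / K * (1 - Real.exp (-K * (τ / 2))) * Real.exp (-K * W) < 1 := by nlinarith
  unfold slackRatio
  nlinarith

section Propagation

variable {H : Fin n → ℝ → ℝ} {t₀ M K c : ℝ}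

theorem slack_decay (hK : 0 < K) (hH : ∀ i, Continuous (H i))
    (hfree : ∀ i, ∀ t ≥ t₀, RightDiniLE (H i) t (K * (M - H i t)))
    {i : Fin n} {s t ε : ℝ} (hs : t₀ ≤ s) (hst : s ≤ t) (hi : H i s ≤ M - ε) :
    H i t ≤ M - ε * Real.exp (-K * (t - s)) := by
  have := RightDiniLE.le_sub_of_forced_decay (e := 0) hK (hH i).continuousOn hst
    (fun r hr => (hfree i r (hs.trans hr.1)).mono (by linarith)) hi
  simpa using this

theorem exists_insert_slack (hc : 0 < c) (hcK : c ≤ K) {T t : ℝ} (hT : 0 < T) (ht0 : 0 ≤ t)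
    (ht : t₀ ≤ t) (hU : ∀ t ≥ (0 : ℝ), D.LConnectedOn (Ico t (t + T)))
    (hH : ∀ i, Continuous (H i)) (hM : ∀ i, ∀ t ≥ t₀, H i t ≤ M)
    (hfree : ∀ i, ∀ t ≥ t₀, RightDiniLE (H i) t (K * (M - H i t)))
    (harc : ∀ i, ∀ t ≥ t₀, ∀ v ε, 0 ≤ ε → ε ≤ M → D.arcAt t v (Sum.inr i) →
      (∀ j, v = Sum.inr j → H j t ≤ M - ε) →
      RightDiniLE (H i) t (K * (M - H i t) - c * ε))
    {S : Finset (Fin n)} (hS : S ≠ Finset.univ) {ε : ℝ} (hε : 0 ≤ ε) (hεM : ε ≤ M)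
    (hSε : ∀ i ∈ S, H i t ≤ M - ε) :
    ∃ i ∉ S, ∀ j ∈ insert i S,
      H j (t + (T + D.τD)) ≤ M - slackRatio c K D.τD (T + D.τD) * ε := by
  have hK := hc.trans_le hcK
  have hτ := D.τD_pos
  obtain ⟨i, hiS, v, hv, hvS⟩ := exists_boundary_arc (hU (t + D.τD / 2) (by linarith)) hS
  obtain ⟨p, htp, hpW, hact⟩ := exists_arc_interval ht0 hv
  set W := T + D.τD with hWdef
  have hW : 0 < W := by linarith
  have hexp : ∀ r, r ≤ W → Real.exp (-K * W) ≤ Real.exp (-K * r) := fun r hr =>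
    Real.exp_le_exp.2 (by nlinarith)
  have hSlack : ∀ j ∈ S, ∀ r ∈ Icc t (t + W), H j r ≤ M - ε * Real.exp (-K * W) := by
    intro j hj r hr
    refine (slack_decay hK hH hfree ht hr.1 (hSε j hj)).trans ?_
    have := hexp (r - t) (by linarith [hr.2])
    have := mul_le_mul_of_nonneg_left this hε
    linarith
  refine ⟨i, hiS, fun j hj => ?_⟩
  rcases Finset.mem_insert.1 hj with rfl | hj
  · have hE : Real.exp (-K * W) ≤ 1 := Real.exp_le_one_iff.2 (by nlinarith)
    have hE0 := Real.exp_pos (-K * W)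
    have hgain := RightDiniLE.le_sub_of_forced_decay (f := H j) (η := 0)
      (e := c * (ε * Real.exp (-K * W))) hK (hH j).continuousOn
      (show p ≤ p + D.τD / 2 by linarith)
      (fun r hr => harc j r (by linarith [hr.1]) v _ (by positivity) (by nlinarith) (hact r hr)
        fun l hl => hSlack l (hvS l hl) r ⟨by linarith [hr.1], by linarith [hr.2]⟩)
      (by linarith [hM j p (by linarith)])
    rw [add_sub_cancel_left, zero_mul, zero_add] at hgain
    refine (slack_decay hK hH hfree (by linarith) hpW hgain).trans ?_
    have h₁ : 0 ≤ 1 - Real.exp (-K * (D.τD / 2)) :=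
      sub_nonneg.2 (Real.exp_le_one_iff.2 (by nlinarith))
    have h₂ := mul_le_mul_of_nonneg_left (hexp (t + W - (p + D.τD / 2)) (by linarith))
      (show 0 ≤ c * (ε * Real.exp (-K * W)) / K * (1 - Real.exp (-K * (D.τD / 2))) by positivity)
    have h₃ : slackRatio c K D.τD W * ε = c * (ε * Real.exp (-K * W)) / K *
        (1 - Real.exp (-K * (D.τD / 2))) * Real.exp (-K * W) := by
      unfold slackRatio
      ring
    linarith
  · refine (hSlack j hj _ ⟨by linarith, le_rfl⟩).trans ?_
    have := mul_le_mul_of_nonneg_left (slackRatio_lt_exp (τ := D.τD) hc hcK hτ hW).le hε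
    linarith

theorem slack_of_windows (hc : 0 < c) (hcK : c ≤ K) {T : ℝ} (hT : 0 < T) (ht₀ : 0 ≤ t₀)
    (hU : ∀ t ≥ (0 : ℝ), D.LConnectedOn (Ico t (t + T))) (hM0 : 0 ≤ M)
    (hH : ∀ i, Continuous (H i)) (hM : ∀ i, ∀ t ≥ t₀, H i t ≤ M)
    (hfree : ∀ i, ∀ t ≥ t₀, RightDiniLE (H i) t (K * (M - H i t)))
    (harc : ∀ i, ∀ t ≥ t₀, ∀ v ε, 0 ≤ ε → ε ≤ M → D.arcAt t v (Sum.inr i) →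
      (∀ j, v = Sum.inr j → H j t ≤ M - ε) →
      RightDiniLE (H i) t (K * (M - H i t) - c * ε)) (i : Fin n) :
    H i (t₀ + n * (T + D.τD)) ≤ (1 - slackRatio c K D.τD (T + D.τD) ^ n) * M := by
  have hK := hc.trans_le hcK
  have hτ := D.τD_pos
  set ρ := slackRatio c K D.τD (T + D.τD) with hρ
  have hW : 0 < T + D.τD := by linarith
  have hρ0 : 0 < ρ := slackRatio_pos hc hK hτ
  have hρ1 : ρ < 1 := (slackRatio_lt_exp hc hcK hτ hW).trans
    (Real.exp_lt_one_iff.2 (by nlinarith))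
  have key : ∀ m : ℕ, ∃ S : Finset (Fin n), min m n ≤ S.card ∧
      ∀ i ∈ S, H i (t₀ + m * (T + D.τD)) ≤ M - ρ ^ m * M := by
    intro m
    induction m with
    | zero => exact ⟨∅, by simp, by simp⟩
    | succ m ih =>
      obtain ⟨S, hcard, hS⟩ := ih
      have hpow0 : 0 < ρ ^ m := pow_pos hρ0 m
      have hpow1 : ρ ^ m ≤ 1 := pow_le_one₀ hρ0.le hρ1.le
      have htm : t₀ ≤ t₀ + m * (T + D.τD) := by
        have : 0 ≤ (m : ℝ) * (T + D.τD) := by positivity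
        linarith
      have hnext : t₀ + ((m + 1 : ℕ) : ℝ) * (T + D.τD) =
          t₀ + m * (T + D.τD) + (T + D.τD) := by
        push_cast
        ring
      rw [hnext, pow_succ']
      by_cases huniv : S = Finset.univ
      · refine ⟨S, by simp [huniv], fun i hi => ?_⟩
        refine (slack_decay hK hH hfree htm (by linarith) (hS i hi)).trans ?_
        rw [add_sub_cancel_left]
        have := mul_le_mul_of_nonneg_left
          (slackRatio_lt_exp (τ := D.τD) hc hcK hτ hW).le (mul_nonneg hpow0.le hM0)
        rw [← hρ] at this
        linarith
      · obtain ⟨i, hi, hins⟩ := exists_insert_slack hc hcK hT (ht₀.trans htm) htm hU hH hM hfree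
          harc huniv (mul_nonneg hpow0.le hM0) (by nlinarith) hS
        refine ⟨insert i S, ?_, fun j hj => (hins j hj).trans_eq (by rw [hρ]; ring)⟩
        rw [Finset.card_insert_of_notMem hi]
        omega
  obtain ⟨S, hcard, hS⟩ := key n
  have huniv : S = Finset.univ := by
    rw [← Finset.card_eq_iff_eq_univ, Fintype.card_fin]
    have := Finset.card_le_univ S
    rw [Fintype.card_fin] at this
    rw [min_self] at hcard
    omega
  have := hS i (by simp [huniv])
  linarith

end Propagation

end MASData

namespace MASSol

variable {d n k : ℕ} {D : MASData d n k} (sol : MASSol D)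

theorem norm_u_le_znorm (j : Fin k) (t : ℝ) : ‖sol.u j (sol.y t) t‖ ≤ sol.znorm t := by
  refine Real.le_sqrt_of_sq_le ?_
  have h₁ := Finset.single_le_sum (f := fun j => ‖sol.u j (sol.y t) t‖ ^ 2)
    (fun j _ => sq_nonneg _) (Finset.mem_univ j)
  have h₂ : 0 ≤ ∑ i : Fin n, ‖sol.w i t‖ ^ 2 := by positivity
  linarith

theorem norm_w_le_znorm (i : Fin n) (t : ℝ) : ‖sol.w i t‖ ≤ sol.znorm t := by
  refine Real.le_sqrt_of_sq_le ?_
  have h₁ := Finset.single_le_sum (f := fun i => ‖sol.w i t‖ ^ 2)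
    (fun j _ => sq_nonneg _) (Finset.mem_univ i)
  have h₂ : 0 ≤ ∑ j : Fin k, ‖sol.u j (sol.y t) t‖ ^ 2 := by positivity
  linarith

theorem znorm_le_zsup {sol : MASSol D} (hz : sol.zBounded) {t : ℝ} (ht : 0 ≤ t) :
    sol.znorm t ≤ sol.zsup :=
  le_csSup hz ⟨t, ht, rfl⟩

theorem zsup_nonneg : 0 ≤ sol.zsup := by
  refine Real.sSup_nonneg ?_
  rintro _ ⟨t, -, rfl⟩
  exact Real.sqrt_nonneg _

/-- The distance from follower `i` to the convex hull of the leaders. -/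
def followerDist (i : Fin n) (t : ℝ) : ℝ := infDist (sol.x t i) (sol.Lset t)

theorem followerDist_nonneg (i : Fin n) (t : ℝ) : 0 ≤ sol.followerDist i t := infDist_nonneg

theorem followerDist_le_distL (i : Fin n) (t : ℝ) : sol.followerDist i t ≤ sol.distL t :=
  le_ciSup (f := fun i => sol.followerDist i t) (finite_range _).bddAbove i

theorem distL_nonneg (t : ℝ) : 0 ≤ sol.distL t :=
  Real.iSup_nonneg fun i => sol.followerDist_nonneg i t

theorem continuous_followerDist (i : Fin n) : Continuous (sol.followerDist i) := by
  have : Nonempty (Fin k) := ⟨⟨0, D.hk⟩⟩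
  have hbound : ∀ s t, sol.followerDist i s ≤ sol.followerDist i t +
      (dist (sol.x s i) (sol.x t i) + ∑ j, dist (sol.y s j) (sol.y t j)) := by
    intro s t
    have h₁ := infDist_convexHull_range_le (y := sol.y t) (y' := sol.y s)
      (e := ∑ j, dist (sol.y s j) (sol.y t j))
      (fun j => by
        rw [dist_comm]
        exact Finset.single_le_sum (f := fun j => dist (sol.y s j) (sol.y t j))
          (fun _ _ => dist_nonneg) (Finset.mem_univ j)) (sol.x s i)
    have h₂ := infDist_le_infDist_add_dist (s := sol.Lset t) (x := sol.x s i) (y := sol.x t i)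
    simp only [followerDist, Lset] at *
    linarith
  refine continuous_iff_continuousAt.2 fun t => tendsto_iff_dist_tendsto_zero.2 ?_
  have hlim : Tendsto (fun s => dist (sol.x s i) (sol.x t i) + ∑ j, dist (sol.y s j) (sol.y t j))
      (𝓝 t) (𝓝 0) := by
    have hx := sol.x_cont i
    have hy := sol.y_cont
    have hc : Continuous fun s =>
        dist (sol.x s i) (sol.x t i) + ∑ j, dist (sol.y s j) (sol.y t j) := by fun_prop
    simpa using hc.tendsto t
  refine squeeze_zero (fun _ => dist_nonneg) (fun s => ?_) hlim
  rw [Real.dist_eq, abs_le]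
  have h₁ := hbound s t
  have h₂ := hbound t s
  simp only [dist_comm (sol.x t i), dist_comm (sol.y t _)] at h₂
  constructor <;> linarith

/-- The vector field of follower `i` along the solution, without the disturbance. -/
def coupling (i : Fin n) (t : ℝ) : EuclideanSpace ℝ (Fin d) :=
  (∑ j ∈ D.Nb t i, D.A i j (sol.x t) (sol.y t) t • (sol.x t j - sol.x t i)) +
    ∑ j ∈ D.Ld t i, D.B i j (sol.x t) (sol.y t) t • (sol.y t j - sol.x t i)

/-- The rate at which the coupling changes the distance of follower `i`. -/
def couplingRate (i : Fin n) (t : ℝ) : ℝ :=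
  (∑ j ∈ D.Nb t i, D.A i j (sol.x t) (sol.y t) t *
      (sol.followerDist j t - sol.followerDist i t)) -
    (∑ j ∈ D.Ld t i, D.B i j (sol.x t) (sol.y t) t) * sol.followerDist i t

theorem infDist_add_smul_coupling_le (i : Fin n) (t : ℝ) {σ : ℝ} (hσ : 0 ≤ σ)
    (hσ1 : σ * ((∑ j ∈ D.Nb t i, D.A i j (sol.x t) (sol.y t) t) +
      ∑ j ∈ D.Ld t i, D.B i j (sol.x t) (sol.y t) t) ≤ 1) :
    infDist (sol.x t i + σ • sol.coupling i t) (sol.Lset t) ≤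
      sol.followerDist i t + σ * sol.couplingRate i t := by
  have : Nonempty (Fin k) := ⟨⟨0, D.hk⟩⟩
  have hconv := convexOn_infDist (convex_convexHull ℝ (range (sol.y t)))
    (range_nonempty (sol.y t)).convexHull
  have hA : ∀ j, 0 ≤ D.A i j (sol.x t) (sol.y t) t := fun j =>
    D.aLo_pos.le.trans (D.A_bdd i j _ _ t).1
  have hB : ∀ j, 0 ≤ D.B i j (sol.x t) (sol.y t) t := fun j =>
    D.bLo_pos.le.trans (D.B_bdd i j _ _ t)
  have h := hconv.map_add_sum_smul_sub_le ((D.Nb t i).disjSum (D.Ld t i))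
    (c := Sum.elim (fun j => σ * D.A i j (sol.x t) (sol.y t) t)
      (fun j => σ * D.B i j (sol.x t) (sol.y t) t))
    (Sum.elim (sol.x t) (sol.y t)) (sol.x t i)
    (by rintro (j | j) - <;> simp [mul_nonneg hσ, hA, hB])
    (by
      rw [Finset.sum_disjSum]
      simpa only [Sum.elim_inl, Sum.elim_inr, ← Finset.mul_sum, ← mul_add] using hσ1)
  rw [Finset.sum_disjSum, Finset.sum_disjSum] at h
  simp only [Sum.elim_inl, Sum.elim_inr] at h
  have hzero : ∀ j, infDist (sol.y t j) (convexHull ℝ (range (sol.y t))) = 0 := fun j =>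
    infDist_zero_of_mem (subset_convexHull ℝ _ (mem_range_self j))
  simp only [hzero, zero_sub, mul_smul, ← Finset.smul_sum, ← smul_add] at h
  refine h.trans_eq ?_
  simp only [followerDist, couplingRate, Lset, mul_assoc, ← Finset.mul_sum, mul_neg,
    Finset.sum_neg_distrib, Finset.sum_mul]
  ring

theorem rightDiniLE_followerDist {sol : MASSol D} (hz : sol.zBounded) (i : Fin n) {t : ℝ}
    (ht : 0 ≤ t) :
    RightDiniLE (sol.followerDist i) t (sol.couplingRate i t + 2 * sol.zsup) := by
  intro r hr
  have : Nonempty (Fin k) := ⟨⟨0, D.hk⟩⟩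
  set ε := (r - (sol.couplingRate i t + 2 * sol.zsup)) / 3 with hεdef
  have hε : 0 < ε := by linarith
  have hx := ((sol.dyn_x i t ht).isLittleO.def hε).filter_mono
    (nhdsWithin_mono t Ioi_subset_Ici_self)
  have hy : ∀ᶠ s in 𝓝[>] t, ∀ j, ‖sol.y s j - sol.y t j - (s - t) • sol.u j (sol.y t) t‖ ≤
      ε * ‖s - t‖ := eventually_all.2 fun j =>
    ((sol.dyn_y j t ht).isLittleO.def hε).filter_mono (nhdsWithin_mono t Ioi_subset_Ici_self)
  have hsmall : ∀ᶠ s in 𝓝[>] t, (s - t) * ((∑ j ∈ D.Nb t i, D.A i j (sol.x t) (sol.y t) t) +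
      ∑ j ∈ D.Ld t i, D.B i j (sol.x t) (sol.y t) t) < 1 := by
    refine (ContinuousAt.eventually_lt (Continuous.continuousAt (by fun_prop))
      continuousAt_const ?_).filter_mono nhdsWithin_le_nhds
    simp
  filter_upwards [hx, hy, hsmall, self_mem_nhdsWithin] with s hxs hys hss hst
  have hst : 0 < s - t := sub_pos.2 hst
  rw [Real.norm_of_nonneg hst.le] at hxs hys
  have hu : ∀ j, dist (sol.y t j) (sol.y s j) ≤ (s - t) * (sol.zsup + ε) := by
    intro j
    rw [dist_comm, dist_eq_norm]
    have h₁ := norm_le_norm_sub_add (sol.y s j - sol.y t j) ((s - t) • sol.u j (sol.y t) t)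
    rw [norm_smul, Real.norm_of_nonneg hst.le] at h₁
    have h₂ := mul_le_mul_of_nonneg_left
      ((sol.norm_u_le_znorm j t).trans (znorm_le_zsup hz ht)) hst.le
    linarith [hys j]
  have hmove := infDist_convexHull_range_le hu (sol.x s i)
  have hcpl := sol.infDist_add_smul_coupling_le i t hst.le hss.le
  have htri := infDist_le_infDist_add_dist (s := sol.Lset t) (x := sol.x s i)
    (y := sol.x t i + (s - t) • sol.coupling i t)
  have hres : dist (sol.x s i) (sol.x t i + (s - t) • sol.coupling i t) ≤
      (s - t) * (sol.zsup + ε) := by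
    rw [dist_eq_norm]
    have h₁ := mul_le_mul_of_nonneg_left
      ((sol.norm_w_le_znorm i t).trans (znorm_le_zsup hz ht)) hst.le
    have h₂ := norm_add_le (sol.x s i - sol.x t i - (s - t) • (sol.coupling i t + sol.w i t))
      ((s - t) • sol.w i t)
    rw [norm_smul, Real.norm_of_nonneg hst.le] at h₂
    have h₃ : sol.x s i - (sol.x t i + (s - t) • sol.coupling i t) =
        sol.x s i - sol.x t i - (s - t) • (sol.coupling i t + sol.w i t) +
          (s - t) • sol.w i t := by
      rw [smul_add]
      abel
    rw [h₃]
    have h₄ : ‖sol.x s i - sol.x t i - (s - t) • (sol.coupling i t + sol.w i t)‖ ≤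
      ε * (s - t) := hxs
    linarith
  rw [inv_mul_lt_iff₀ hst]
  have hpos := mul_pos hst hε
  have hr' : (s - t) * r =
      (s - t) * sol.couplingRate i t + 2 * ((s - t) * sol.zsup) + 3 * ((s - t) * ε) := by
    rw [hεdef]
    ring
  simp only [followerDist, Lset] at *
  linarith

theorem couplingRate_nonpos {i : Fin n} {t : ℝ}
    (hi : ∀ j, sol.followerDist j t ≤ sol.followerDist i t) : sol.couplingRate i t ≤ 0 := by
  have hA : ∑ j ∈ D.Nb t i, D.A i j (sol.x t) (sol.y t) t *
      (sol.followerDist j t - sol.followerDist i t) ≤ 0 := Finset.sum_nonpos fun j _ =>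
    mul_nonpos_of_nonneg_of_nonpos (D.aLo_pos.le.trans (D.A_bdd i j _ _ t).1)
      (sub_nonpos.2 (hi j))
  have hB : 0 ≤ ∑ j ∈ D.Ld t i, D.B i j (sol.x t) (sol.y t) t := Finset.sum_nonneg fun j _ =>
    D.bLo_pos.le.trans (D.B_bdd i j _ _ t)
  have := mul_nonneg hB (sol.followerDist_nonneg i t)
  unfold couplingRate
  linarith

theorem distL_le_add {sol : MASSol D} (hz : sol.zBounded) {t₀ t : ℝ} (ht₀ : 0 ≤ t₀)
    (ht : t₀ ≤ t) : sol.distL t ≤ sol.distL t₀ + 2 * sol.zsup * (t - t₀) := by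
  have : Nonempty (Fin n) := ⟨⟨0, by have := D.hn; omega⟩⟩
  have hcont : Continuous sol.distL := by
    have : sol.distL = fun t =>
        Finset.univ.sup' Finset.univ_nonempty fun i => sol.followerDist i t := by
      funext t
      exact (Finset.sup'_univ_eq_ciSup _).symm
    rw [this]
    exact Continuous.finset_sup'_apply _ fun i _ => sol.continuous_followerDist i
  have h := RightDiniLE.le_gronwallBound (f := sol.distL) (f' := fun _ => 2 * sol.zsup) (K := 0)
    (ε := 2 * sol.zsup) hcont.continuousOn
    (fun s hs => RightDiniLE.ciSup sol.continuous_followerDist fun i hi =>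
      (rightDiniLE_followerDist hz i (ht₀.trans hs.1)).mono
        (by linarith [sol.couplingRate_nonpos hi]))
    le_rfl (fun _ _ => by simp) ht
  rwa [gronwallBound_K0] at h

end MASSol

namespace MASSol

variable {d n k : ℕ} {D : MASData d n k} (sol : MASSol D)

theorem couplingRate_le {i : Fin n} {t N : ℝ} (hN : ∀ j, sol.followerDist j t ≤ N) :
    sol.couplingRate i t ≤ n * D.aHi * (N - sol.followerDist i t) -
      (∑ j ∈ D.Nb t i, D.A i j (sol.x t) (sol.y t) t * (N - sol.followerDist j t)) -
      (∑ j ∈ D.Ld t i, D.B i j (sol.x t) (sol.y t) t) * sol.followerDist i t := by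
  have haHi : 0 ≤ D.aHi :=
    D.aLo_pos.le.trans ((D.A_bdd i i (sol.x t) (sol.y t) t).1.trans (D.A_bdd i i _ _ t).2)
  have hsum : ∑ j ∈ D.Nb t i, D.A i j (sol.x t) (sol.y t) t ≤ n * D.aHi := by
    refine (Finset.sum_le_card_nsmul _ _ D.aHi fun j _ => (D.A_bdd i j _ _ t).2).trans ?_
    rw [nsmul_eq_mul]
    have hcard := Finset.card_le_univ (D.Nb t i)
    rw [Fintype.card_fin] at hcard
    gcongr
  have h := mul_le_mul_of_nonneg_right hsum (sub_nonneg.2 (hN i))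
  have hsplit : ∑ j ∈ D.Nb t i, D.A i j (sol.x t) (sol.y t) t *
      (sol.followerDist j t - sol.followerDist i t) =
      (∑ j ∈ D.Nb t i, D.A i j (sol.x t) (sol.y t) t) * (N - sol.followerDist i t) -
        ∑ j ∈ D.Nb t i, D.A i j (sol.x t) (sol.y t) t * (N - sol.followerDist j t) := by
    rw [Finset.sum_mul, ← Finset.sum_sub_distrib]
    exact Finset.sum_congr rfl fun j _ => by ring
  unfold couplingRate
  rw [hsplit]
  linarith

theorem couplingRate_le_of_forall_le {i : Fin n} {t N : ℝ}
    (hN : ∀ j, sol.followerDist j t ≤ N) :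
    sol.couplingRate i t ≤ (n * D.aHi + D.bLo) * (N - sol.followerDist i t) := by
  have h := sol.couplingRate_le (i := i) hN
  have hA : 0 ≤ ∑ j ∈ D.Nb t i, D.A i j (sol.x t) (sol.y t) t * (N - sol.followerDist j t) :=
    Finset.sum_nonneg fun j _ =>
      mul_nonneg (D.aLo_pos.le.trans (D.A_bdd i j _ _ t).1) (sub_nonneg.2 (hN j))
  have hB : 0 ≤ ∑ j ∈ D.Ld t i, D.B i j (sol.x t) (sol.y t) t := Finset.sum_nonneg fun j _ =>
    D.bLo_pos.le.trans (D.B_bdd i j _ _ t)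
  have hBi := mul_nonneg hB (sol.followerDist_nonneg i t)
  have hb := mul_nonneg D.bLo_pos.le (sub_nonneg.2 (hN i))
  linarith

theorem couplingRate_le_of_arcAt {i : Fin n} {t M δ ε : ℝ} (hδ : 0 ≤ δ) (hε : 0 ≤ ε)
    (hεM : ε ≤ M) (hM : ∀ j, sol.followerDist j t ≤ M + δ) {v : Fin k ⊕ Fin n}
    (hv : D.arcAt t v (Sum.inr i))
    (hvε : ∀ j, v = Sum.inr j → sol.followerDist j t ≤ M + δ - ε) :
    sol.couplingRate i t ≤
      (n * D.aHi + D.bLo) * (M + δ - sol.followerDist i t) - min D.aLo D.bLo * ε := by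
  have h := sol.couplingRate_le (i := i) hM
  have hAterm : ∀ j, 0 ≤ D.A i j (sol.x t) (sol.y t) t * (M + δ - sol.followerDist j t) :=
    fun j => mul_nonneg (D.aLo_pos.le.trans (D.A_bdd i j _ _ t).1) (sub_nonneg.2 (hM j))
  have hBterm : ∀ j, 0 ≤ D.B i j (sol.x t) (sol.y t) t := fun j =>
    D.bLo_pos.le.trans (D.B_bdd i j _ _ t)
  have hdist := sol.followerDist_nonneg i t
  have hb := mul_nonneg D.bLo_pos.le (sub_nonneg.2 (hM i))
  rcases v with j | j
  · have hA := Finset.sum_nonneg fun j (_ : j ∈ D.Nb t i) => hAterm j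
    have hB : D.bLo ≤ ∑ j ∈ D.Ld t i, D.B i j (sol.x t) (sol.y t) t :=
      (D.B_bdd i j _ _ t).trans (Finset.single_le_sum
        (f := fun j => D.B i j (sol.x t) (sol.y t) t) (fun j _ => hBterm j) hv)
    have hBi := mul_le_mul_of_nonneg_right hB hdist
    have hc := mul_le_mul (min_le_right D.aLo D.bLo) (hεM.trans (le_add_of_nonneg_right hδ)) hε
      D.bLo_pos.le
    linarith
  · have hA := Finset.single_le_sum
      (f := fun j => D.A i j (sol.x t) (sol.y t) t * (M + δ - sol.followerDist j t))
      (fun j _ => hAterm j) (show j ∈ D.Nb t i from hv)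
    have hAj : min D.aLo D.bLo * ε ≤
        D.A i j (sol.x t) (sol.y t) t * (M + δ - sol.followerDist j t) :=
      mul_le_mul ((min_le_left _ _).trans (D.A_bdd i j _ _ t).1) (by linarith [hvε j rfl]) hε
        (D.aLo_pos.le.trans (D.A_bdd i j _ _ t).1)
    have hBi := mul_nonneg (Finset.sum_nonneg fun j (_ : j ∈ D.Ld t i) => hBterm j) hdist
    linarith

end MASSol

theorem MASData.UJLC.exists_contraction {d n k : ℕ} {D : MASData d n k} (hU : D.UJLC) :
    ∃ Γ > (0 : ℝ), ∃ η > (0 : ℝ), η < 1 ∧ ∀ sol : MASSol D, sol.zBounded → ∀ t ≥ (0 : ℝ),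
      sol.distL (t + Γ) ≤ (1 - η) * sol.distL t + 2 * sol.zsup * Γ := by
  obtain ⟨T, hT, hU⟩ := hU
  have hn := D.hn
  have hn0 : (0 : ℝ) < n := by exact_mod_cast (by omega : 0 < n)
  have : Nonempty (Fin n) := ⟨⟨0, by omega⟩⟩
  have hτ := D.τD_pos
  have haHi : 0 ≤ D.aHi :=
    let i : Fin n := Classical.arbitrary _
    D.aLo_pos.le.trans ((D.A_bdd i i 0 0 0).1.trans (D.A_bdd i i 0 0 0).2)
  set K := n * D.aHi + D.bLo
  set c := min D.aLo D.bLo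
  have hc : 0 < c := lt_min D.aLo_pos D.bLo_pos
  have hcK : c ≤ K := (min_le_right _ _).trans (le_add_of_nonneg_left (by positivity))
  have hK : 0 < K := hc.trans_le hcK
  have hW : 0 < T + D.τD := by linarith
  have hρ0 := slackRatio_pos (W := T + D.τD) hc hK hτ
  have hρ1 : slackRatio c K D.τD (T + D.τD) < 1 := (slackRatio_lt_exp hc hcK hτ hW).trans
    (Real.exp_lt_one_iff.2 (by nlinarith))
  refine ⟨n * (T + D.τD), by positivity, slackRatio c K D.τD (T + D.τD) ^ n, pow_pos hρ0 n,
    pow_lt_one₀ hρ0.le hρ1 (by omega), fun sol hz t₀ ht₀ => ciSup_le fun i => ?_⟩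
  set q := 2 * sol.zsup
  have hq : 0 ≤ q := mul_nonneg two_pos.le sol.zsup_nonneg
  have hbound : ∀ i, ∀ t ≥ t₀, sol.followerDist i t ≤ sol.distL t₀ + q * (t - t₀) :=
    fun i t ht => (sol.followerDist_le_distL i t).trans (MASSol.distL_le_add hz ht₀ ht)
  have hdini : ∀ i, ∀ t ≥ t₀, RightDiniLE (fun s => sol.followerDist i s - q * (s - t₀)) t
      (sol.couplingRate i t) := fun i t ht =>
    ((MASSol.rightDiniLE_followerDist hz i (ht₀.trans ht)).sub_linear q t₀).mono
      (add_sub_cancel_right _ _).le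
  have h := slack_of_windows (H := fun i t => sol.followerDist i t - q * (t - t₀))
    (M := sol.distL t₀) hc hcK hT ht₀ hU (sol.distL_nonneg t₀)
    (fun i => (sol.continuous_followerDist i).sub (by fun_prop))
    (fun i t ht => by linarith [hbound i t ht])
    (fun i t ht => (hdini i t ht).mono
      ((sol.couplingRate_le_of_forall_le fun j => hbound j t ht).trans_eq (by ring)))
    (fun i t ht v ε hε hεM hv hvε => (hdini i t ht).mono
      ((sol.couplingRate_le_of_arcAt (mul_nonneg hq (sub_nonneg.2 ht)) hε hεM
        (fun j => hbound j t ht) hv fun j hj => by linarith [hvε j hj]).trans_eq (by ring))) i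
  rw [add_sub_cancel_left] at h
  exact sub_le_iff_le_add.1 h

theorem isClassKL_mul_pow_floor {r Γ : ℝ} (hr0 : 0 < r) (hr1 : r < 1) (hΓ : 0 < Γ) :
    IsClassKL fun s t => r ^ ⌊t / Γ⌋₊ * s := by
  refine ⟨fun t _ => ⟨by fun_prop, fun a _ b _ hab => ?_, mul_zero _⟩, fun s hs => ⟨?_, ?_⟩⟩
  · exact mul_lt_mul_of_pos_left hab (pow_pos hr0 _)
  · intro a _ b _ hab
    exact mul_le_mul_of_nonneg_right (pow_le_pow_of_le_one hr0.le hr1.le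
      (Nat.floor_mono (div_le_div_of_nonneg_right hab hΓ.le))) hs
  · have h := (tendsto_pow_atTop_nhds_zero_of_lt_one hr0.le hr1).comp
      (tendsto_nat_floor_atTop.comp (tendsto_id.atTop_div_const hΓ))
    simpa using h.mul_const s

theorem MASData.UJLC.exists_linear_gain {d n k : ℕ} {D : MASData d n k} (hU : D.UJLC) :
    ∃ β : ℝ → ℝ → ℝ, ∃ c : ℝ, IsClassKL β ∧ 0 < c ∧
      ∀ sol : MASSol D, sol.zBounded → ∀ t ≥ (0:ℝ),
        sol.distL t ≤ β (sol.distL 0) t + c * sol.zsup := by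
  obtain ⟨Γ, hΓ, η, hη, hη1, hcontr⟩ := hU.exists_contraction
  refine ⟨fun s t => (1 - η) ^ ⌊t / Γ⌋₊ * s, 2 * Γ / η + 2 * Γ,
    isClassKL_mul_pow_floor (sub_pos.2 hη1) (by linarith) hΓ, by positivity,
    fun sol hz t ht => ?_⟩
  have hZ := sol.zsup_nonneg
  have hiter : ∀ m : ℕ,
      sol.distL (m * Γ) ≤ (1 - η) ^ m * sol.distL 0 + 2 * Γ / η * sol.zsup := by
    intro m
    induction m with
    | zero =>
      simp only [Nat.cast_zero, zero_mul, pow_zero, one_mul]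
      exact le_add_of_nonneg_right (by positivity)
    | succ m ih =>
      have h := hcontr sol hz (m * Γ) (by positivity)
      have hstep := mul_le_mul_of_nonneg_left ih (sub_pos.2 hη1).le
      have hfix : (1 - η) * (2 * Γ / η * sol.zsup) + 2 * sol.zsup * Γ =
          2 * Γ / η * sol.zsup := by
        field_simp
        ring
      rw [pow_succ', show ((m + 1 : ℕ) : ℝ) * Γ = m * Γ + Γ by push_cast; ring]
      linarith
  have hfloor : ⌊t / Γ⌋₊ * Γ ≤ t := (le_div_iff₀ hΓ).1 (Nat.floor_le (by positivity))
  have hfloor' : t - ⌊t / Γ⌋₊ * Γ ≤ Γ := by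
    have := (div_lt_iff₀ hΓ).1 (Nat.lt_floor_add_one (t / Γ))
    linarith
  have h := MASSol.distL_le_add hz (by positivity) hfloor
  have hlast := mul_le_mul_of_nonneg_left hfloor' (mul_nonneg two_pos.le hZ)
  have := hiter ⌊t / Γ⌋₊
  simp only
  linarith

/-- **Theorem 5 ("if" part).**  If the switching interaction graph is uniformly
jointly L-connected, then system (5) is SISS with respect to `ℒ(y(t))` with
input `z`; moreover the gain `γ` can be taken linear: `γ(s) = c·s`. -/
theorem ujlc_implies_SISS {d n k : ℕ} (D : MASData d n k) (hU : D.UJLC) :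
    D.SISS ∧
    ∃ β : ℝ → ℝ → ℝ, ∃ c : ℝ, IsClassKL β ∧ 0 < c ∧
      ∀ sol : MASSol D, sol.zBounded → ∀ t ≥ (0:ℝ),
        sol.distL t ≤ β (sol.distL 0) t + c * sol.zsup := by
  obtain ⟨β, c, hβ, hc, h⟩ := hU.exists_linear_gain
  refine ⟨⟨β, fun s => c * s, hβ, ⟨by fun_prop, fun a _ b _ hab => ?_, mul_zero c⟩, h⟩,
    β, c, hβ, hc, h⟩
  exact mul_lt_mul_of_pos_left hab hc
end
end

section
/- Suppose the switching signal σ has dwell time τ_D and G_{σ(t)} is uniformly jointly L-connected with constant T, and set T₀ = T + 2τ_D. Then for any t > 0 and any follower i ∈ 𝒱_F there exist a leader j ∈ 𝒱_L and a directed path from j to i in the union graph G([t, t + T₀)) such that each arc of the path belongs to G_{σ(s)} for all s in some subinterval of [t, t + T₀) of length at least τ_D. -/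
open Metric Set Filter

noncomputable section

/-- The arc relation of the communication graph at time `t`, on the node set
`Fin k ⊕ Fin n` (leaders ⊕ followers): `Ld t i` is the set of leaders with an
arc into follower `i` and `Nb t i` the set of follower-neighbors of follower
`i`; there are no arcs from followers into leaders. -/
def arcAt {n k : ℕ} (Nb : ℝ → Fin n → Finset (Fin n)) (Ld : ℝ → Fin n → Finset (Fin k))
    (t : ℝ) (v v' : Fin k ⊕ Fin n) : Prop :=
  match v, v' with
  | Sum.inl j, Sum.inr i => j ∈ Ld t i
  | Sum.inr j, Sum.inr i => j ∈ Nb t i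
  | _, _ => False

/-- Arc relation of the union graph over the set of times `T`. -/
def arcOn {n k : ℕ} (Nb : ℝ → Fin n → Finset (Fin n)) (Ld : ℝ → Fin n → Finset (Fin k))
    (T : Set ℝ) (v v' : Fin k ⊕ Fin n) : Prop :=
  ∃ t ∈ T, arcAt Nb Ld t v v'

/-- A sequence whose gaps are at least `τ > 0` partitions `[s 0, ∞)` into consecutive intervals. -/
theorem exists_mem_Ico_of_add_le {s : ℕ → ℝ} {τ : ℝ} (hτ : 0 < τ)
    (hs : ∀ m, s m + τ ≤ s (m + 1)) {r : ℝ} (hr : s 0 ≤ r) :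
    ∃ m, r ∈ Set.Ico (s m) (s (m + 1)) := by
  have hgrow : ∀ m : ℕ, s 0 + m * τ ≤ s m := by
    intro m
    induction m with
    | zero => simp
    | succ m ih => push_cast; linarith [hs m]
  obtain ⟨N, hN⟩ := exists_nat_gt ((r - s 0) / τ)
  rw [div_lt_iff₀ hτ] at hN
  by_contra! h
  have hle : ∀ m, s m ≤ r := by
    intro m
    induction m with
    | zero => exact hr
    | succ m ih => exact not_lt.mp fun hlt => h m ⟨ih, hlt⟩
  linarith [hgrow N, hle N]

/-- If consecutive switching instants are at least `τ` apart, then every arc present at time `r`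
persists over a half-open interval of length `τ` starting in `[r - τ, r]`. -/
theorem exists_persistent_arc {n k : ℕ} {Nb : ℝ → Fin n → Finset (Fin n)}
    {Ld : ℝ → Fin n → Finset (Fin k)} {s : ℕ → ℝ} {τ : ℝ} (hτ : 0 < τ)
    (hs : ∀ m, s m + τ ≤ s (m + 1))
    (hconst : ∀ m : ℕ, ∀ t₁ ∈ Set.Ico (s m) (s (m + 1)), ∀ t₂ ∈ Set.Ico (s m) (s (m + 1)),
      Nb t₁ = Nb t₂ ∧ Ld t₁ = Ld t₂)
    {r : ℝ} (hr : s 0 ≤ r) {v v' : Fin k ⊕ Fin n} (hv : arcAt Nb Ld r v v') :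
    ∃ s₀ ∈ Set.Icc (r - τ) r, ∀ u ∈ Set.Ico s₀ (s₀ + τ), arcAt Nb Ld u v v' := by
  obtain ⟨m, hm⟩ := exists_mem_Ico_of_add_le hτ hs hr
  refine ⟨max (s m) (r - τ), ⟨le_max_right _ _, max_le hm.1 (by linarith)⟩, fun u hu => ?_⟩
  have hend : max (s m) (r - τ) ≤ s (m + 1) - τ :=
    max_le (by linarith [hs m]) (by linarith [hm.2])
  obtain ⟨hNb, hLd⟩ :=
    hconst m u ⟨(le_max_left _ _).trans hu.1, by linarith [hu.2]⟩ r hm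
  simpa only [arcAt, hNb, hLd] using hv

/-- **Lemma 5.**  Suppose the switching signal is piecewise constant with dwell
time `τD > 0` and the graph is uniformly jointly L-connected with constant
`T > 0`.  Set `T₀ = T + 2 τD`.  Then for any `t > 0` and any follower `i` there
is a leader `j` and a directed path from `j` to `i` in the union graph over
`[t, t + T₀)`, each arc of which is present in `G_{σ(s)}` for all `s` in some
subinterval of `[t, t + T₀)` of length at least `τD`. -/
theorem ujlc_persistent_path {n k : ℕ}
    (Nb : ℝ → Fin n → Finset (Fin n)) (Ld : ℝ → Fin n → Finset (Fin k))
    (τD : ℝ) (hτ : 0 < τD)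
    (dwell : ∃ s : ℕ → ℝ, s 0 = 0 ∧ (∀ m : ℕ, s m + τD ≤ s (m + 1)) ∧
      ∀ m : ℕ, ∀ t₁ ∈ Set.Ico (s m) (s (m + 1)), ∀ t₂ ∈ Set.Ico (s m) (s (m + 1)),
        Nb t₁ = Nb t₂ ∧ Ld t₁ = Ld t₂)
    (T : ℝ) (hT : 0 < T)
    (hUJLC : ∀ t ≥ (0:ℝ), ∀ i : Fin n, ∃ j : Fin k,
      Relation.ReflTransGen (arcOn Nb Ld (Set.Ico t (t + T))) (Sum.inl j) (Sum.inr i)) :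
    ∀ t > (0:ℝ), ∀ i : Fin n, ∃ j : Fin k,
      Relation.ReflTransGen
        (fun v v' => ∃ s₀ : ℝ, Set.Ico s₀ (s₀ + τD) ⊆ Set.Ico t (t + (T + 2 * τD)) ∧
          ∀ s ∈ Set.Ico s₀ (s₀ + τD), arcAt Nb Ld s v v')
        (Sum.inl j) (Sum.inr i) := by
  obtain ⟨s, hs0, hs, hconst⟩ := dwell
  intro t ht i
  obtain ⟨j, hj⟩ := hUJLC (t + τD) (by linarith) i
  refine ⟨j, Relation.ReflTransGen.mono ?_ _ _ hj⟩
  rintro v v' ⟨r, ⟨hr₁, hr₂⟩, hv⟩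
  obtain ⟨s₀, ⟨h₁, h₂⟩, h⟩ := exists_persistent_arc hτ hs hconst (by linarith) hv
  exact ⟨s₀, Set.Ico_subset_Ico (by linarith) (by linarith), h⟩
end
end
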